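/- arXiv:1912.03757 — 2 statements merged into one kernel-verified Lean document; each statement's English description precedes it below -/
import Mathlib

section
/- Let A be a Young function and ξ<0, and assume ∫_0^c A(s) s^{1/ξ−1} ds < ∞ for some c>0. Define E_ξ(t) := |ξ|^{−1} t^{−1/ξ} ∫_0^t A(s) s^{1/ξ−1} ds for t∈(0,∞), an increasing bijection of (0,∞) onto itself with inverse E_ξ^{−1}. Then for every a∈(0,∞) one has ‖t^ξ χ_{(a,∞)}(t)‖_{L^A(0,∞)} = a^ξ / E_ξ^{−1}(1/a). -/
open MeasureTheory Filter Set Real Topology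
open scoped ENNReal

noncomputable section

/-- `A` is a Young function with density `a`. -/
def IsYoungWith (A a : ℝ → ℝ) : Prop :=
  a 0 = 0 ∧ (∀ s, 0 < s → 0 < a s) ∧
  MonotoneOn a (Set.Ici 0) ∧
  (∀ s, 0 ≤ s → ContinuousWithinAt a (Set.Ici s) s) ∧
  Filter.Tendsto a Filter.atTop Filter.atTop ∧
  (∀ t, 0 ≤ t → A t = ∫ s in (0:ℝ)..t, a s)

/-- `A` is a Young function. -/
def IsYoung (A : ℝ → ℝ) : Prop := ∃ a, IsYoungWith A a

/-- The Luxemburg norm of `f` in the Orlicz space `L^A(S)`. -/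
def luxNorm (A : ℝ → ℝ) (S : Set ℝ) (f : ℝ → ℝ) : ℝ :=
  sInf {lam : ℝ | 0 < lam ∧ (∫⁻ t in S, ENNReal.ofReal (A (|f t| / lam))) ≤ 1}

/-- `E_ξ(t) = |ξ|⁻¹ t^{-1/ξ} ∫₀ᵗ A(s) s^{1/ξ-1} ds`. -/
def Efun (A : ℝ → ℝ) (ξ : ℝ) (t : ℝ) : ℝ :=
  |ξ|⁻¹ * t ^ (-(1/ξ)) * ∫ s in Set.Ioo (0:ℝ) t, A s * s ^ (1/ξ - 1)

theorem young_nonneg (A : ℝ → ℝ) (hA : IsYoung A) (t : ℝ) (ht : 0 ≤ t) : 0 ≤ A t := by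
  obtain ⟨b, h0, hpos, -, -, -, h⟩ := hA
  rw [h t ht]
  apply intervalIntegral.integral_nonneg ht
  intro u hu
  rcases hu.1.eq_or_lt with h1 | h1
  · rw [← h1, h0]
  · exact (hpos u h1).le

theorem young_zero (A : ℝ → ℝ) (hA : IsYoung A) : A 0 = 0 := by
  obtain ⟨b, h0, hpos, -, -, -, h⟩ := hA
  rw [h 0 le_rfl]; simp

theorem lint_eq (A : ℝ → ℝ) (hA : IsYoung A) (ξ : ℝ) (hξ : ξ < 0) (a : ℝ) (ha : 0 < a)
    (l : ℝ) (hl : 0 < l) (hE : 0 < Efun A ξ (a ^ ξ / l)) :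
    (∫⁻ t in Set.Ioi (0:ℝ),
      ENNReal.ofReal (A (|(Set.Ioi a).indicator (fun t => t ^ ξ) t| / l)))
      = ENNReal.ofReal (a * Efun A ξ (a ^ ξ / l)) := by
  have hξ0 : ξ ≠ 0 := hξ.ne
  set T := a ^ ξ / l with hT
  have hTpos : 0 < T := div_pos (rpow_pos_of_pos ha _) hl
  have hint : IntegrableOn (fun s => A s * s ^ (1/ξ - 1)) (Ioo 0 T) := by
    by_contra hcon
    have h0 : (∫ s in Ioo (0:ℝ) T, A s * s ^ (1/ξ - 1)) = 0 := integral_undef hcon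
    unfold Efun at hE
    rw [h0] at hE
    simp at hE
  have step1 : (∫⁻ t in Set.Ioi (0:ℝ),
      ENNReal.ofReal (A (|(Set.Ioi a).indicator (fun t => t ^ ξ) t| / l)))
      = ∫⁻ t in Set.Ioi a, ENNReal.ofReal (A (t ^ ξ / l)) := by
    have h1 : ∀ t, ENNReal.ofReal (A (|(Set.Ioi a).indicator (fun t => t ^ ξ) t| / l))
        = (Set.Ioi a).indicator (fun t => ENNReal.ofReal (A (t ^ ξ / l))) t := by
      intro t
      by_cases ht : t ∈ Ioi a
      · rw [indicator_of_mem ht, indicator_of_mem ht,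
          abs_of_pos (rpow_pos_of_pos (ha.trans ht) _)]
      · rw [indicator_of_notMem ht, indicator_of_notMem ht]
        simp [young_zero A hA]
    simp_rw [h1]
    rw [lintegral_indicator measurableSet_Ioi, Measure.restrict_restrict measurableSet_Ioi,
      inter_eq_left.2 (Ioi_subset_Ioi ha.le)]
  have hinv : ∀ s, 0 < s → ((l * s) ^ (1/ξ)) ^ ξ / l = s := by
    intro s hs
    rw [← rpow_mul (mul_pos hl hs).le, one_div_mul_cancel hξ0, rpow_one]
    field_simp
  have himg : (fun s => (l * s) ^ (1/ξ)) '' Ioo 0 T = Ioi a := by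
    ext t
    constructor
    · rintro ⟨s, ⟨hs0, hsT⟩, rfl⟩
      have h2 : l * s < a ^ ξ := by
        rw [hT, lt_div_iff₀ hl] at hsT; linarith
      have h3 := rpow_lt_rpow_of_neg (mul_pos hl hs0) h2 (one_div_neg.2 hξ)
      rw [← rpow_mul ha.le, mul_one_div_cancel hξ0, rpow_one] at h3
      exact h3
    · intro ht
      have ht0 : 0 < t := ha.trans ht
      refine ⟨t ^ ξ / l, ⟨div_pos (rpow_pos_of_pos ht0 _) hl, ?_⟩, ?_⟩
      · exact div_lt_div_of_pos_right (rpow_lt_rpow_of_neg ha ht hξ) hl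
      · have : l * (t ^ ξ / l) = t ^ ξ := by field_simp
        simp only [this]
        rw [← rpow_mul ht0.le, mul_one_div_cancel hξ0, rpow_one]
  have hinj : InjOn (fun s => (l * s) ^ (1/ξ)) (Ioo 0 T) := by
    intro s hs s' hs' h
    have h' : (l * s) ^ (1/ξ) = (l * s') ^ (1/ξ) := h
    rw [← hinv s hs.1, ← hinv s' hs'.1, h']
  have hder : ∀ s ∈ Ioo 0 T, HasDerivWithinAt (fun s => (l * s) ^ (1/ξ))
      (l * (1/ξ) * (l * s) ^ (1/ξ - 1)) (Ioo 0 T) s := by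
    intro s hs
    have h4 : HasDerivAt (fun s => l * s) l s := by
      simpa using (hasDerivAt_id s).const_mul l
    exact (h4.rpow_const (Or.inl (mul_pos hl hs.1).ne')).hasDerivWithinAt
  have hK : a * (|ξ|⁻¹ * T ^ (-(1/ξ))) = |ξ|⁻¹ * l ^ (1/ξ) := by
    have : T ^ (-(1/ξ)) = a⁻¹ * l ^ (1/ξ) := by
      rw [hT, div_rpow (rpow_nonneg ha.le _) hl.le, ← rpow_mul ha.le, mul_neg,
        mul_one_div_cancel hξ0, rpow_neg_one, rpow_neg hl.le, div_inv_eq_mul]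
    rw [this]; field_simp
  rw [step1, ← himg, lintegral_image_eq_lintegral_abs_deriv_mul measurableSet_Ioo hder hinj]
  have h5 : ∀ s ∈ Ioo 0 T, ENNReal.ofReal |l * (1/ξ) * (l * s) ^ (1/ξ - 1)| *
      ENNReal.ofReal (A (((l * s) ^ (1/ξ)) ^ ξ / l))
      = ENNReal.ofReal ((|ξ|⁻¹ * l ^ (1/ξ)) * (A s * s ^ (1/ξ - 1))) := by
    intro s hs
    rw [hinv s hs.1, ← ENNReal.ofReal_mul (abs_nonneg _)]
    congr 1
    rw [abs_mul, abs_mul, abs_of_pos hl, abs_of_pos (rpow_pos_of_pos (mul_pos hl hs.1) _),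
      mul_rpow hl.le hs.1.le, rpow_sub hl, rpow_one, abs_div, abs_one]
    field_simp
  rw [setLIntegral_congr_fun measurableSet_Ioo h5, ← ofReal_integral_eq_lintegral_ofReal]
  · rw [integral_const_mul, ← hK]
    unfold Efun
    congr 1
    ring
  · exact hint.const_mul _
  · refine (ae_restrict_iff' measurableSet_Ioo).2 (Eventually.of_forall ?_)
    intro s hs
    have := young_nonneg A hA s hs.1.le
    have := hs.1
    have := rpow_pos_of_pos this (1/ξ - 1)
    show 0 ≤ _
    positivity

theorem statement2 (A : ℝ → ℝ) (hA : IsYoung A) (ξ : ℝ) (hξ : ξ < 0)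
    (c : ℝ) (hc : 0 < c)
    (hconv : MeasureTheory.IntegrableOn (fun s => A s * s ^ (1/ξ - 1)) (Set.Ioo 0 c))
    (hmono : StrictMonoOn (Efun A ξ) (Set.Ioi 0))
    (honto : Efun A ξ '' Set.Ioi 0 = Set.Ioi 0)
    (Einv : ℝ → ℝ)
    (hEinv : ∀ t, 0 < t → 0 < Einv t ∧ Efun A ξ (Einv t) = t ∧ Einv (Efun A ξ t) = t)
    (a : ℝ) (ha : 0 < a) :
    luxNorm A (Set.Ioi (0:ℝ)) ((Set.Ioi a).indicator fun t => t ^ ξ)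
      = a ^ ξ / Einv (1 / a) := by
  have hEpos : ∀ t, 0 < t → 0 < Efun A ξ t := by
    intro t ht
    have : Efun A ξ t ∈ Efun A ξ '' Set.Ioi 0 := mem_image_of_mem _ ht
    rw [honto] at this
    exact this
  obtain ⟨hτ, hEτ, -⟩ := hEinv (1 / a) (by positivity)
  set τ := Einv (1 / a) with hτdef
  have hap : 0 < a ^ ξ := rpow_pos_of_pos ha _
  have hset : {lam : ℝ | 0 < lam ∧ (∫⁻ t in Set.Ioi (0:ℝ),
      ENNReal.ofReal (A (|(Set.Ioi a).indicator (fun t => t ^ ξ) t| / lam))) ≤ 1}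
      = Ici (a ^ ξ / τ) := by
    ext l
    have key : 0 < l → ((∫⁻ t in Set.Ioi (0:ℝ),
        ENNReal.ofReal (A (|(Set.Ioi a).indicator (fun t => t ^ ξ) t| / l))) ≤ 1
        ↔ a ^ ξ / τ ≤ l) := by
      intro hl
      have hTpos : 0 < a ^ ξ / l := div_pos hap hl
      rw [lint_eq A hA ξ hξ a ha l hl (hEpos _ hTpos), ENNReal.ofReal_le_one,
        ← le_div_iff₀' ha, ← hEτ, hmono.le_iff_le hTpos hτ, div_le_iff₀ hl, div_le_iff₀ hτ,
        mul_comm]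
    constructor
    · rintro ⟨hl, h⟩
      exact (key hl).1 h
    · intro h
      have hl : 0 < l := lt_of_lt_of_le (div_pos hap hτ) h
      exact ⟨hl, (key hl).2 h⟩
  unfold luxNorm
  rw [hset, csInf_Ici]
end
end

section
/- Let 0<α<1 and let A and B be Young functions such that for some constants c₀,C>0: ∫_1^t A(s) s^{−1/(1−α)−1} ds ≤ c₀ · B(Ct) · t^{−1/(1−α)} for all t∈(2,∞). Assume moreover that lim_{t→∞} B(t)/t^{1/(1−α)} = ∞ and that for every K≥1: limsup_{t→∞} (t^{1/(1−α)}/B(Kt)) ∫_1^t B(s) s^{−1/(1−α)−1} ds = ∞. Then there exists a Young function A₁ such that A₁(t) ≥ A(t) for all t≥0, limsup_{t→∞} A₁(t)/A(λt) = ∞ for every λ>0, and for some c₁>0: ∫_1^t A₁(s) s^{−1/(1−α)−1} ds ≤ c₁ · B(Ct) · t^{−1/(1−α)} for all t∈(2,∞). -/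
open MeasureTheory Filter Set Real Topology
open scoped ENNReal

noncomputable section

theorem young_mono {A : ℝ → ℝ} (hA : IsYoung A) :
    MonotoneOn A (Set.Ici 0) ∧ ∀ t, 0 < t → 0 < A t := by
  obtain ⟨a, h0, hpos, hm, -, -, hint⟩ := hA
  have hnn : ∀ s, 0 ≤ s → 0 ≤ a s := by
    intro s hs
    have := hm (mem_Ici.2 le_rfl) (mem_Ici.2 hs) hs
    linarith
  have hii : ∀ x y, 0 ≤ x → 0 ≤ y → IntervalIntegrable a volume x y := by
    intro x y hx hy
    apply MonotoneOn.intervalIntegrable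
    apply hm.mono
    intro z hz
    exact le_trans (le_min hx hy) hz.1
  constructor
  · intro x hx y hy hxy
    rw [mem_Ici] at hx hy
    rw [hint x hx, hint y hy, ← intervalIntegral.integral_add_adjacent_intervals
      (hii 0 x le_rfl hx) (hii x y hx hy)]
    have : 0 ≤ ∫ s in x..y, a s :=
      intervalIntegral.integral_nonneg hxy (fun u hu => hnn u (hx.trans hu.1))
    linarith
  · intro t ht
    rw [hint t ht.le]
    exact intervalIntegral.intervalIntegral_pos_of_pos_on (hii 0 t le_rfl ht.le)
      (fun x hx => hpos x hx.1) ht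

theorem mono_ii {f : ℝ → ℝ} (hf : MonotoneOn f (Set.Ici 0)) (r : ℝ) {x y : ℝ}
    (hx : 0 < x) (hy : 0 < y) :
    IntervalIntegrable (fun s => f s * s ^ r) volume x y := by
  apply IntervalIntegrable.mul_continuousOn
  · apply MonotoneOn.intervalIntegrable
    apply hf.mono
    intro z hz
    exact le_trans (le_min hx.le hy.le) hz.1
  · intro z hz
    have : 0 < z := lt_of_lt_of_le (lt_min hx hy) hz.1
    exact (Real.continuousAt_rpow_const z r (Or.inl this.ne')).continuousWithinAt

theorem int_nonneg {f : ℝ → ℝ} (hf : ∀ t, 0 < t → 0 < f t) (r : ℝ) {x y : ℝ}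
    (hx : 0 < x) (hxy : x ≤ y) : 0 ≤ ∫ s in x..y, f s * s ^ r := by
  apply intervalIntegral.integral_nonneg hxy
  intro u hu
  have : 0 < u := hx.trans_le hu.1
  have := hf u this
  positivity

theorem ioo_eq (g : ℝ → ℝ) {t : ℝ} (ht : 1 ≤ t) :
    ∫ s in Set.Ioo (1:ℝ) t, g s = ∫ s in (1:ℝ)..t, g s := by
  rw [intervalIntegral.integral_of_le ht, integral_Ioc_eq_integral_Ioo]

theorem dyadic {A : ℝ → ℝ} (hAm : MonotoneOn A (Set.Ici 0)) (hAp : ∀ t, 0 < t → 0 < A t)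
    {p : ℝ} (hp : 1 < p) {x : ℝ} (hx : 0 < x) :
    A x * x ^ (-p) ≤ 2 ^ (p + 1) * ∫ s in x..(2 * x), A s * s ^ (-p - 1) := by
  have h1 : ∫ s in x..(2 * x), A x * (2 * x) ^ (-p - 1) ≤
      ∫ s in x..(2 * x), A s * s ^ (-p - 1) := by
    apply intervalIntegral.integral_mono_on (by linarith) (by simp)
      (mono_ii hAm _ hx (by linarith))
    intro s hs
    have hs0 : 0 < s := hx.trans_le hs.1
    apply mul_le_mul (hAm (mem_Ici.2 hx.le) (mem_Ici.2 hs0.le) hs.1) _ (by positivity)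
      (hAp s hs0).le
    exact Real.rpow_le_rpow_of_nonpos hs0 hs.2 (by linarith)
  rw [intervalIntegral.integral_const, smul_eq_mul] at h1
  have h2 : (2 * x) ^ (-p - 1) = (2 ^ (p + 1))⁻¹ * (x ^ (-p) * x⁻¹) := by
    rw [Real.mul_rpow (by norm_num) hx.le, ← Real.rpow_neg (by norm_num),
      Real.rpow_sub hx, Real.rpow_one]
    congr 1
    congr 1
    ring
  have h3 : (0:ℝ) < 2 ^ (p + 1) := by positivity
  rw [h2] at h1
  calc A x * x ^ (-p) = 2 ^ (p + 1) * ((2 * x - x) * (A x * ((2 ^ (p + 1))⁻¹ * (x ^ (-p) * x⁻¹)))) := by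
        field_simp
        ring
    _ ≤ _ := by gcongr

theorem no_dom {p : ℝ} (hp : 1 < p) {A B : ℝ → ℝ}
    (hAm : MonotoneOn A (Set.Ici 0)) (hAp : ∀ t, 0 < t → 0 < A t)
    (hBm : MonotoneOn B (Set.Ici 0)) (hBp : ∀ t, 0 < t → 0 < B t)
    {c₀ C : ℝ} (hc₀ : 0 < c₀) (hC : 0 < C)
    (hred : ∀ t : ℝ, 2 < t → (∫ s in (1:ℝ)..t, A s * s ^ (-p - 1)) ≤ c₀ * B (C * t) * t ^ (-p))
    (hBlim : Tendsto (fun t => B t / t ^ p) atTop atTop)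
    (hlimsup : ∀ K : ℝ, 1 ≤ K → ∀ M : ℝ, ∃ᶠ t in atTop,
      M ≤ (t ^ p / B (K * t)) * ∫ s in Set.Ioo (1:ℝ) t, B s * s ^ (-p - 1))
    {l : ℝ} (hl : 1 ≤ l) {N : ℝ} (hN : 0 < N)
    (hdom : ∀ᶠ τ in atTop, B (C * τ) ≤ N * A (l * τ)) : False := by
  obtain ⟨T, hT⟩ := eventually_atTop.1 hdom
  have hl0 : 0 < l := by linarith
  set μ := l / C with hμ
  have hμ0 : 0 < μ := by positivity
  obtain ⟨S, hS1, hST, hSμ⟩ : ∃ S : ℝ, 1 ≤ S ∧ C * T ≤ S ∧ 1 ≤ μ * S := by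
    refine ⟨max 1 (max (C * T) (1 / μ)), le_max_left _ _,
      (le_max_left _ _).trans (le_max_right _ _), ?_⟩
    have h : 1 / μ ≤ max 1 (max (C * T) (1 / μ)) := (le_max_right _ _).trans (le_max_right _ _)
    rwa [div_le_iff₀' hμ0] at h
  have hBA : ∀ s, S ≤ s → B s ≤ N * A (μ * s) := by
    intro s hs
    have := hT (s / C) (by rw [le_div_iff₀' hC]; linarith)
    rw [show C * (s / C) = s by field_simp, show l * (s / C) = μ * s by rw [hμ]; ring] at this
    exact this
  have key : ∀ t, S ≤ t → 2 < μ * t →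
      (∫ s in S..t, B s * s ^ (-p - 1)) ≤ N * c₀ * (B (l * t) * t ^ (-p)) := by
    intro t hSt hmt
    have hS0 : 0 < S := by linarith
    have ht0 : 0 < t := by linarith
    have hcomp : ∀ s ∈ Set.Icc S t, B s * s ^ (-p - 1) ≤
        N * μ ^ (p + 1) * (A (μ * s) * (μ * s) ^ (-p - 1)) := by
      intro s hs
      have hs0 : 0 < s := hS0.trans_le hs.1
      have h1 : μ ^ (p + 1) * (μ * s) ^ (-p - 1) = s ^ (-p - 1) := by
        rw [Real.mul_rpow hμ0.le hs0.le, ← mul_assoc, ← Real.rpow_add hμ0]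
        simp
      calc B s * s ^ (-p - 1) ≤ N * A (μ * s) * s ^ (-p - 1) := by
            gcongr
            exact hBA s hs.1
        _ = _ := by rw [← h1]; ring
    have hii : IntervalIntegrable (fun s => N * μ ^ (p + 1) * (A (μ * s) * (μ * s) ^ (-p - 1)))
        volume S t := by
      have hm : MonotoneOn (fun s => A (μ * s)) (Set.Ici 0) := by
        intro x hx y hy hxy
        exact hAm (mem_Ici.2 (mul_nonneg hμ0.le hx)) (mem_Ici.2 (mul_nonneg hμ0.le hy)) (by gcongr)
      have := (mono_ii hm (-p - 1) hS0 ht0).const_mul N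
      refine this.congr ?_
      intro s hs
      rw [uIoc_of_le hSt] at hs
      have hs0 : 0 < s := hS0.trans hs.1
      have h1 : μ ^ (p + 1) * (μ * s) ^ (-p - 1) = s ^ (-p - 1) := by
        rw [Real.mul_rpow hμ0.le hs0.le, ← mul_assoc, ← Real.rpow_add hμ0]
        simp
      simp only
      rw [← h1]; ring
    have h2 := intervalIntegral.integral_mono_on hSt (mono_ii hBm (-p - 1) hS0 ht0) hii hcomp
    rw [intervalIntegral.integral_const_mul,
      intervalIntegral.integral_comp_mul_left (fun x => A x * x ^ (-p - 1)) hμ0.ne', smul_eq_mul] at h2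
    have h3 : (∫ x in (μ * S)..(μ * t), A x * x ^ (-p - 1)) ≤
        ∫ x in (1:ℝ)..(μ * t), A x * x ^ (-p - 1) := by
      rw [← intervalIntegral.integral_add_adjacent_intervals
        (mono_ii hAm (-p - 1) one_pos (by linarith : 0 < μ * S))
        (mono_ii hAm (-p - 1) (by linarith : 0 < μ * S) (by linarith : 0 < μ * t))]
      have := int_nonneg hAp (-p - 1) one_pos hSμ
      linarith
    have h4 := hred (μ * t) hmt
    rw [show C * (μ * t) = l * t by rw [hμ]; field_simp] at h4
    calc _ ≤ _ := h2
      _ ≤ N * μ ^ (p + 1) * (μ⁻¹ * (c₀ * B (l * t) * (μ * t) ^ (-p))) := by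
        gcongr
        exact h3.trans h4
      _ = _ := by
        rw [Real.mul_rpow hμ0.le ht0.le, Real.rpow_add hμ0, Real.rpow_one, Real.rpow_neg hμ0.le]
        field_simp
  set I := ∫ s in (1:ℝ)..S, B s * s ^ (-p - 1) with hI
  have hev : ∀ᶠ t in atTop, I ≤ B (l * t) / (l * t) ^ p := by
    have : Tendsto (fun t : ℝ => l * t) atTop atTop := tendsto_id.const_mul_atTop hl0
    exact (hBlim.comp this).eventually_ge_atTop I
  have hf := hlimsup l hl (N * c₀ + 2)
  obtain ⟨t, ht, hIt, htS, htμ⟩ := (hf.and_eventually (hev.and ((eventually_ge_atTop S).and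
    (eventually_gt_atTop (2 / μ))))).exists
  have ht0 : 0 < t := by linarith
  have hBt : 0 < B (l * t) := hBp _ (by positivity)
  have hk := key t htS (by rwa [div_lt_iff₀' hμ0] at htμ)
  rw [ioo_eq _ (by linarith : 1 ≤ t), ← intervalIntegral.integral_add_adjacent_intervals
        (mono_ii hBm (-p - 1) one_pos (by linarith : 0 < S))
        (mono_ii hBm (-p - 1) (by linarith : 0 < S) ht0), ← hI] at ht
  have htp : 0 < t ^ p := by positivity
  have h5 : I ≤ B (l * t) * t ^ (-p) := by
    refine hIt.trans ?_
    rw [Real.rpow_neg ht0.le, ← div_eq_mul_inv]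
    have : t ≤ l * t := by nlinarith
    gcongr
  have h6 : t ^ p / B (l * t) * (I + ∫ s in S..t, B s * s ^ (-p - 1)) ≤
      t ^ p / B (l * t) * (B (l * t) * t ^ (-p) + N * c₀ * (B (l * t) * t ^ (-p))) := by
    gcongr
  have h7 : t ^ p / B (l * t) * (B (l * t) * t ^ (-p) + N * c₀ * (B (l * t) * t ^ (-p)))
      = 1 + N * c₀ := by
    rw [Real.rpow_neg ht0.le]
    field_simp
  linarith

theorem claim {p : ℝ} (hp : 1 < p) {A B : ℝ → ℝ}
    (hAm : MonotoneOn A (Set.Ici 0)) (hAp : ∀ t, 0 < t → 0 < A t)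
    (hBm : MonotoneOn B (Set.Ici 0)) (hBp : ∀ t, 0 < t → 0 < B t)
    {c₀ C : ℝ} (hc₀ : 0 < c₀) (hC : 0 < C)
    (hred : ∀ t : ℝ, 2 < t → (∫ s in (1:ℝ)..t, A s * s ^ (-p - 1)) ≤ c₀ * B (C * t) * t ^ (-p))
    (hBlim : Tendsto (fun t => B t / t ^ p) atTop atTop)
    (hlimsup : ∀ K : ℝ, 1 ≤ K → ∀ M : ℝ, ∃ᶠ t in atTop,
      M ≤ (t ^ p / B (K * t)) * ∫ s in Set.Ioo (1:ℝ) t, B s * s ^ (-p - 1))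
    {l : ℝ} (hl : 1 ≤ l) {M : ℝ} (hM : 0 < M) :
    ∃ᶠ τ in atTop, ∀ t, τ ≤ t → M * (A (l * τ) * τ ^ (-p)) ≤ B (C * t) * t ^ (-p) := by
  by_contra hcon
  rw [not_frequently] at hcon
  have hl0 : 0 < l := by linarith
  obtain ⟨T, hT⟩ := eventually_atTop.1 hcon
  set F : ℝ → ℝ := fun t => ∫ s in (1:ℝ)..t, A s * s ^ (-p - 1) with hF
  have hFadd : ∀ x y, 0 < x → 0 < y → F y = F x + ∫ s in x..y, A s * s ^ (-p - 1) := by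
    intro x y hx hy
    exact (intervalIntegral.integral_add_adjacent_intervals
        (mono_ii hAm (-p - 1) one_pos hx) (mono_ii hAm (-p - 1) hx hy)).symm
  have hFm : ∀ x y, 0 < x → x ≤ y → F x ≤ F y := by
    intro x y hx hxy
    rw [hFadd x y hx (by linarith)]
    have := int_nonneg hAp (-p - 1) hx hxy
    linarith
  have hFp : ∀ x, 1 < x → 0 < F x := by
    intro x hx
    apply intervalIntegral.intervalIntegral_pos_of_pos_on (mono_ii hAm _ one_pos (by linarith)) _ hx
    intro s hs
    have h0 : 0 < s := one_pos.trans hs.1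
    have := hAp s h0
    positivity
  set D : ℝ := l ^ p * 2 ^ (p + 1) with hD
  have hD0 : 0 < D := by positivity
  have hAF : ∀ τ, 0 < τ → A (l * τ) * τ ^ (-p) ≤ D * (F (2 * l * τ) - F τ) := by
    intro τ hτ
    have h1 := dyadic hAm hAp hp (mul_pos hl0 hτ)
    have h2 := hFadd (l * τ) (2 * (l * τ)) (by positivity) (by positivity)
    have h3 := hFm τ (l * τ) hτ (by nlinarith)
    have h4 : A (l * τ) * τ ^ (-p) = l ^ p * (A (l * τ) * (l * τ) ^ (-p)) := by
      rw [Real.mul_rpow hl0.le hτ.le, Real.rpow_neg hl0.le]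
      field_simp
    rw [h4, hD, mul_assoc (l ^ p)]
    apply mul_le_mul_of_nonneg_left _ (by positivity)
    refine h1.trans ?_
    apply mul_le_mul_of_nonneg_left _ (by positivity)
    rw [mul_assoc 2 l τ]
    linarith
  set δ : ℝ := 1 / (c₀ * M * D) with hδ
  have hδ0 : 0 < δ := by positivity
  have hT' : ∀ τ, max T 3 ≤ τ → ∃ t, τ ≤ t ∧ B (C * t) * t ^ (-p) < M * (A (l * τ) * τ ^ (-p)) := by
    intro τ hτ
    have := hT τ ((le_max_left _ _).trans hτ)
    push Not at this
    exact this
  have hgrow : ∀ τ, max T 3 ≤ τ → (1 + δ) * F τ ≤ F (2 * l * τ) := by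
    intro τ hτ
    obtain ⟨t, htτ, ht⟩ := hT' τ hτ
    have hτ3 : 3 ≤ τ := (le_max_right _ _).trans hτ
    have h1 := hFm τ t (by linarith) htτ
    have h2 := hred t (by linarith)
    have h3 := hAF τ (by linarith)
    have h4 : F τ ≤ c₀ * M * D * (F (2 * l * τ) - F τ) := by
      calc F τ ≤ c₀ * (B (C * t) * t ^ (-p)) := by rw [← mul_assoc]; exact h1.trans h2
        _ ≤ c₀ * (M * (A (l * τ) * τ ^ (-p))) := by gcongr
        _ ≤ c₀ * (M * (D * (F (2 * l * τ) - F τ))) := by gcongr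
        _ = _ := by ring
    have h5 : δ * F τ ≤ F (2 * l * τ) - F τ := by
      rw [hδ, one_div, inv_mul_le_iff₀ (by positivity)]
      exact h4
    linarith
  have hq : 1 ≤ 2 * l := by linarith
  have hgrow_n : ∀ n : ℕ, ∀ τ, max T 3 ≤ τ → (1 + δ) ^ n * F τ ≤ F ((2 * l) ^ n * τ) := by
    intro n
    induction n with
    | zero => intro τ _; simp
    | succ n ih =>
      intro τ hτ
      have hτ3 : 3 ≤ τ := (le_max_right _ _).trans hτ
      have h1 : τ ≤ (2 * l) ^ n * τ := by
        have := one_le_pow₀ hq (n := n)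
        nlinarith
      have h2 := hgrow ((2 * l) ^ n * τ) (hτ.trans h1)
      have h3 := ih τ hτ
      calc (1 + δ) ^ (n + 1) * F τ = (1 + δ) * ((1 + δ) ^ n * F τ) := by ring
        _ ≤ (1 + δ) * F ((2 * l) ^ n * τ) := by gcongr
        _ ≤ _ := h2
        _ = _ := by rw [← mul_assoc]; congr 2; ring
  obtain ⟨n, hn⟩ := pow_unbounded_of_one_lt (c₀ * M * D) (by linarith : 1 < 1 + δ)
  set L : ℝ := (2 * l) ^ (n + 1) with hL
  have hL0 : 0 < L := by positivity
  refine no_dom hp hAm hAp hBm hBp hc₀ hC hred hBlim hlimsup hl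
    (N := L ^ p * M) (by positivity) ?_
  filter_upwards [eventually_ge_atTop (max T 3)] with τ hτ
  obtain ⟨t, htτ, ht⟩ := hT' τ hτ
  have hτ3 : 3 ≤ τ := (le_max_right _ _).trans hτ
  have hτ0 : 0 < τ := by linarith
  have ht0 : 0 < t := by linarith
  have htL : t ≤ L * τ := by
    by_contra hlt
    push Not at hlt
    have h2l : τ ≤ 2 * l * τ := by nlinarith
    have h1 := hgrow_n n (2 * l * τ) (hτ.trans h2l)
    have h2 : F ((2 * l) ^ n * (2 * l * τ)) ≤ F t := by
      apply hFm _ _ (by positivity)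
      rw [hL, pow_succ] at hlt
      linarith
    have h3 := hred t (by linarith)
    have h4 := hAF τ hτ0
    have hFτ := hFp τ (by linarith)
    have hF2 := hFp (2 * l * τ) (by linarith)
    have h5 : F t ≤ c₀ * M * D * F (2 * l * τ) := by
      calc F t ≤ c₀ * (B (C * t) * t ^ (-p)) := by rw [← mul_assoc]; exact h3
        _ ≤ c₀ * (M * (A (l * τ) * τ ^ (-p))) := by gcongr
        _ ≤ c₀ * (M * (D * (F (2 * l * τ) - F τ))) := by gcongr
        _ ≤ c₀ * (M * (D * (F (2 * l * τ)))) := by gcongr; linarith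
        _ = _ := by ring
    have h6 : c₀ * M * D * F (2 * l * τ) < (1 + δ) ^ n * F (2 * l * τ) := by gcongr
    linarith
  have hAl : 0 < A (l * τ) := hAp _ (by positivity)
  have hB1 : B (C * τ) ≤ B (C * t) :=
    hBm (mem_Ici.2 (by positivity)) (mem_Ici.2 (by positivity)) (by gcongr)
  have hr : t ^ p * τ ^ (-p) ≤ L ^ p := by
    rw [Real.rpow_neg hτ0.le, ← div_eq_mul_inv, div_le_iff₀ (by positivity),
      ← Real.mul_rpow hL0.le hτ0.le]
    gcongr
  calc B (C * τ) ≤ B (C * t) := hB1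
    _ = t ^ p * (B (C * t) * t ^ (-p)) := by
      rw [Real.rpow_neg ht0.le]
      field_simp
    _ ≤ t ^ p * (M * (A (l * τ) * τ ^ (-p))) := by gcongr
    _ = (t ^ p * τ ^ (-p)) * (M * A (l * τ)) := by ring
    _ ≤ L ^ p * (M * A (l * τ)) := by gcongr
    _ = _ := by ring

theorem build {p : ℝ} (hp : 1 < p) {A B : ℝ → ℝ} (hA : IsYoung A)
    (hBp : ∀ t, 0 < t → 0 < B t) {c₀ C : ℝ} (hc₀ : 0 < c₀) (hC : 0 < C)
    (hred : ∀ t : ℝ, 2 < t → (∫ s in (1:ℝ)..t, A s * s ^ (-p - 1)) ≤ c₀ * B (C * t) * t ^ (-p))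
    (hcl : ∀ l : ℝ, 1 ≤ l → ∀ M : ℝ, 0 < M →
      ∃ᶠ τ in atTop, ∀ t, τ ≤ t → M * (A (l * τ) * τ ^ (-p)) ≤ B (C * t) * t ^ (-p)) :
    ∃ A₁ : ℝ → ℝ, IsYoung A₁ ∧
      (∀ t, 0 ≤ t → A t ≤ A₁ t) ∧
      (∀ lam : ℝ, 0 < lam → ∀ M : ℝ, ∃ᶠ t in Filter.atTop, M ≤ A₁ t / A (lam * t)) ∧
      ∃ c₁ : ℝ, 0 < c₁ ∧ ∀ t : ℝ, 2 < t →
        (∫ s in (1:ℝ)..t, A₁ s * s ^ (-p - 1)) ≤ c₁ * B (C * t) * t ^ (-p) := by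
  obtain ⟨hAm, hAp⟩ := young_mono hA
  have hex : ∀ k : ℕ, ∃ τ : ℝ, (k:ℝ) + 1 < τ ∧ ∀ t, τ ≤ t →
      (2 ^ k * ((k:ℝ) + 1)) * (A ((2 * ((k:ℝ) + 1)) * τ) * τ ^ (-p)) ≤ B (C * t) * t ^ (-p) := by
    intro k
    have hk : (0:ℝ) ≤ k := k.cast_nonneg
    obtain ⟨τ, h1, h2⟩ := ((hcl (2 * ((k:ℝ) + 1)) (by linarith) (2 ^ k * ((k:ℝ) + 1))
      (by positivity)).and_eventually (eventually_gt_atTop ((k:ℝ) + 1))).exists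
    exact ⟨τ, h2, h1⟩
  choose τ hτk hτ using hex
  have hτ1 : ∀ k, 1 < τ k := fun k => by
    have := hτk k
    have hk : (0:ℝ) ≤ k := k.cast_nonneg
    linarith
  have hτ0 : ∀ k, 0 < τ k := fun k => one_pos.trans (hτ1 k)
  set m : ℕ → ℝ := fun k => ((k:ℝ) + 1) * A ((2 * ((k:ℝ) + 1)) * τ k) / τ k with hm
  have hm0 : ∀ k, 0 < m k := by
    intro k
    have := hτ0 k
    have := hAp ((2 * ((k:ℝ) + 1)) * τ k) (by positivity)
    positivity
  set g : ℕ → ℝ → ℝ := fun k s => if τ k ≤ s then m k else 0 with hg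
  have hg0 : ∀ k s, 0 ≤ g k s := by
    intro k s
    simp only [hg]
    split_ifs
    · exact (hm0 k).le
    · exact le_rfl
  have hgm : ∀ k, Monotone (g k) := by
    intro k x y hxy
    simp only [hg]
    split_ifs with h1 h2
    · exact le_rfl
    · exact absurd (h1.trans hxy) h2
    · exact (hm0 k).le
    · exact le_rfl
  set h : ℝ → ℝ := fun s => ∑ k ∈ Finset.range ⌈s⌉₊, g k s with hh
  have hn : ∀ (n : ℕ) (s : ℝ), s ≤ n → h s = ∑ k ∈ Finset.range n, g k s := by
    intro n s hs
    simp only [hh]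
    apply Finset.sum_subset
    · exact Finset.range_subset_range.2 (Nat.ceil_le.2 hs)
    · intro k _ hk
      simp only [Finset.mem_range, not_lt] at hk
      have h1 := Nat.ceil_le.1 hk
      have h2 := hτk k
      simp only [hg]
      rw [if_neg]
      linarith
  have hh0 : ∀ s, 0 ≤ h s := fun s => Finset.sum_nonneg (fun k _ => hg0 k s)
  have hhm : Monotone h := by
    intro x y hxy
    obtain ⟨n, hyn⟩ := exists_nat_ge y
    rw [hn n x (hxy.trans hyn), hn n y hyn]
    exact Finset.sum_le_sum (fun k _ => hgm k hxy)
  have hhk : ∀ k, m k ≤ h (τ k) := by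
    intro k
    obtain ⟨n, hyn⟩ := exists_nat_ge (τ k)
    rw [hn n _ hyn]
    have hk : k ∈ Finset.range n := by
      rw [Finset.mem_range]
      have := hτk k
      have h2 : (k:ℝ) < n := by linarith
      exact_mod_cast h2
    have := Finset.single_le_sum (f := fun k' => g k' (τ k)) (fun k' _ => hg0 k' (τ k)) hk
    refine le_trans ?_ this
    simp [hg]
  have hgr : ∀ k s, ContinuousWithinAt (g k) (Set.Ici s) s := by
    intro k s
    by_cases hs : τ k ≤ s
    · apply ContinuousWithinAt.congr (f := fun _ => m k) continuousWithinAt_const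
      · intro y hy
        simp only [hg]
        rw [if_pos (hs.trans hy)]
      · simp only [hg]
        rw [if_pos hs]
    · push Not at hs
      apply ContinuousAt.continuousWithinAt
      apply ContinuousAt.congr (f := fun _ => (0:ℝ)) continuousAt_const
      filter_upwards [Iio_mem_nhds hs] with y hy
      simp only [hg]
      rw [if_neg (not_le.2 hy)]
  have hhr : ∀ s, ContinuousWithinAt h (Set.Ici s) s := by
    intro s
    obtain ⟨n, hsn⟩ := exists_nat_gt s
    have h1 : ContinuousWithinAt (fun s => ∑ k ∈ Finset.range n, g k s) (Set.Ici s) s :=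
      tendsto_finsetSum _ (fun k _ => hgr k s)
    refine h1.congr_of_eventuallyEq ?_ (hn n s hsn.le)
    filter_upwards [mem_nhdsWithin_of_mem_nhds (Iio_mem_nhds hsn)] with y hy
    exact hn n y (le_of_lt hy)
  obtain ⟨a, ha0, hapos, ham, har, hat, haint⟩ := hA
  have hii : ∀ x y, 0 ≤ x → 0 ≤ y → IntervalIntegrable a volume x y := by
    intro x y hx hy
    apply MonotoneOn.intervalIntegrable
    apply ham.mono
    intro z hz
    exact le_trans (le_min hx hy) hz.1
  have hhi : ∀ x y, IntervalIntegrable h volume x y := fun x y => hhm.intervalIntegrable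
  set H : ℝ → ℝ := fun t => ∫ s in (0:ℝ)..t, h s with hH
  have hH0 : ∀ t, 0 ≤ t → 0 ≤ H t := fun t ht =>
    intervalIntegral.integral_nonneg ht (fun u _ => hh0 u)
  have hHle : ∀ t, 0 ≤ t → H t ≤ t * h t := by
    intro t ht
    have := intervalIntegral.integral_mono_on ht (hhi 0 t)
      (intervalIntegrable_const (c := h t)) (fun s hs => hhm hs.2)
    simpa using this
  have hHm : MonotoneOn H (Set.Ici 0) := by
    intro x hx y hy hxy
    simp only [hH]
    rw [← intervalIntegral.integral_add_adjacent_intervals (hhi 0 x) (hhi x y)]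
    have : 0 ≤ ∫ s in x..y, h s :=
      intervalIntegral.integral_nonneg hxy (fun u hu => hh0 u)
    linarith
  have hHk : ∀ k : ℕ, ((k:ℝ) + 1) * A ((2 * ((k:ℝ) + 1)) * τ k) ≤ H (2 * τ k) := by
    intro k
    have hk := hτ0 k
    have h1 := intervalIntegral.integral_mono_on (by linarith : τ k ≤ 2 * τ k)
      (intervalIntegrable_const (c := m k)) (hhi (τ k) (2 * τ k))
      (fun s hs => (hhk k).trans (hhm hs.1))
    have h2 := hH0 (τ k) hk.le
    have h3 : H (2 * τ k) = H (τ k) + ∫ s in (τ k)..(2 * τ k), h s :=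
      (intervalIntegral.integral_add_adjacent_intervals (hhi 0 _) (hhi _ _)).symm
    rw [intervalIntegral.integral_const, smul_eq_mul] at h1
    have h4 : (2 * τ k - τ k) * m k = ((k:ℝ) + 1) * A ((2 * ((k:ℝ) + 1)) * τ k) := by
      simp only [hm]
      field_simp
      ring
    linarith
  refine ⟨fun t => A t + H t, ⟨fun s => a s + h s, ?_, ?_, ?_, ?_, ?_, ?_⟩, ?_, ?_, ?_⟩
  · simp [ha0, hh]
  · intro s hs
    have := hapos s hs
    have := hh0 s
    linarith
  · exact ham.add (hhm.monotoneOn _)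
  · intro s hs
    exact (har s hs).add (hhr s)
  · exact tendsto_atTop_mono (fun s => le_add_of_nonneg_right (hh0 s)) hat
  · intro t ht
    rw [intervalIntegral.integral_add (hii 0 t le_rfl ht) (hhi 0 t), ← haint t ht]
  · intro t ht
    have := hH0 t ht
    simp only
    linarith
  · intro lam hlam M
    rw [frequently_atTop]
    intro b
    obtain ⟨k, hk⟩ := exists_nat_ge (max lam (max M b))
    have hk1 : lam ≤ k := (le_max_left _ _).trans hk
    have hk2 : M ≤ k := ((le_max_left _ _).trans (le_max_right _ _)).trans hk
    have hk3 : b ≤ k := ((le_max_right _ _).trans (le_max_right _ _)).trans hk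
    have hkτ := hτk k
    have hk0 := hτ0 k
    refine ⟨2 * τ k, by linarith, ?_⟩
    have hpos := hAp (lam * (2 * τ k)) (by positivity)
    have hle : A (lam * (2 * τ k)) ≤ A ((2 * ((k:ℝ) + 1)) * τ k) := by
      apply hAm (mem_Ici.2 (by positivity)) (mem_Ici.2 (by positivity))
      nlinarith
    rw [le_div_iff₀ hpos]
    have h1 := hHk k
    have h2 := hAp (2 * τ k) (by positivity)
    calc M * A (lam * (2 * τ k)) ≤ ((k:ℝ) + 1) * A (lam * (2 * τ k)) := by
          gcongr; linarith
      _ ≤ ((k:ℝ) + 1) * A ((2 * ((k:ℝ) + 1)) * τ k) := by gcongr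
      _ ≤ _ := by linarith
  · have hp1 : 0 < p - 1 := by linarith
    refine ⟨c₀ + 2 / (p - 1), by positivity, ?_⟩
    intro t ht
    have ht0 : 0 < t := by linarith
    have ht1 : 1 ≤ t := by linarith
    have hBt : 0 < B (C * t) * t ^ (-p) := by
      have := hBp (C * t) (by positivity)
      positivity
    obtain ⟨n, htn⟩ := exists_nat_ge t
    have hgi : ∀ k, IntervalIntegrable (fun s => g k s * s ^ (-p)) volume 1 t := fun k =>
      mono_ii ((hgm k).monotoneOn _) (-p) one_pos ht0
    have hgk : ∀ k, (∫ s in (1:ℝ)..t, g k s * s ^ (-p)) ≤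
        (1 / 2) ^ k * (B (C * t) * t ^ (-p) / (p - 1)) := by
      intro k
      by_cases hkt : τ k ≤ t
      · rw [← intervalIntegral.integral_add_adjacent_intervals (b := τ k)
          (mono_ii ((hgm k).monotoneOn _) (-p) one_pos (hτ0 k))
          (mono_ii ((hgm k).monotoneOn _) (-p) (hτ0 k) ht0)]
        have e1 : (∫ s in (1:ℝ)..(τ k), g k s * s ^ (-p)) = 0 := by
          rw [intervalIntegral.integral_of_le (hτ1 k).le, integral_Ioc_eq_integral_Ioo]
          apply setIntegral_eq_zero_of_forall_eq_zero
          intro s hs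
          simp only [hg]
          rw [if_neg (not_le.2 hs.2), zero_mul]
        have e2 : (∫ s in (τ k)..t, g k s * s ^ (-p)) = ∫ s in (τ k)..t, m k * s ^ (-p) := by
          apply intervalIntegral.integral_congr
          intro s hs
          rw [uIcc_of_le hkt] at hs
          simp only [hg]
          rw [if_pos hs.1]
        have e3 : (∫ s in (τ k)..t, s ^ (-p)) ≤ (τ k) ^ (-p) * τ k / (p - 1) := by
          rw [integral_rpow]
          · rw [Real.rpow_add (hτ0 k), Real.rpow_one, show -p + 1 = -(p - 1) by ring, div_neg,
              ← neg_div]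
            have : 0 < t ^ (-(p - 1)) := by positivity
            gcongr
            linarith
          · right
            refine ⟨by linarith, ?_⟩
            intro h0
            rw [uIcc_of_le hkt] at h0
            exact absurd h0.1 (not_le.2 (hτ0 k))
        rw [e1, e2, zero_add, intervalIntegral.integral_const_mul]
        have h1 := hτ k t hkt
        have hk0 := hτ0 k
        have hmk := hm0 k
        calc m k * (∫ s in (τ k)..t, s ^ (-p)) ≤ m k * ((τ k) ^ (-p) * τ k / (p - 1)) := by gcongr
          _ = (1 / 2) ^ k * ((2 ^ k * ((k:ℝ) + 1)) *
              (A ((2 * ((k:ℝ) + 1)) * τ k) * τ k ^ (-p)) / (p - 1)) := by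
            simp only [hm]
            rw [one_div, inv_pow]
            field_simp
          _ ≤ _ := by gcongr
      · have e1 : (∫ s in (1:ℝ)..t, g k s * s ^ (-p)) = 0 := by
          rw [intervalIntegral.integral_of_le ht1]
          apply setIntegral_eq_zero_of_forall_eq_zero
          intro s hs
          simp only [hg]
          rw [if_neg (not_le.2 (hs.2.trans_lt (not_le.1 hkt))), zero_mul]
        rw [e1]
        positivity
    have hHint : (∫ s in (1:ℝ)..t, H s * s ^ (-p - 1)) ≤ 2 / (p - 1) * (B (C * t) * t ^ (-p)) := by
      calc (∫ s in (1:ℝ)..t, H s * s ^ (-p - 1))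
          ≤ ∫ s in (1:ℝ)..t, ∑ k ∈ Finset.range n, g k s * s ^ (-p) := by
            apply intervalIntegral.integral_mono_on ht1 (mono_ii hHm _ one_pos ht0)
            · simp_rw [← Finset.sum_mul]
              refine mono_ii ?_ (-p) one_pos ht0
              intro x _ y _ hxy
              exact Finset.sum_le_sum (fun k _ => hgm k hxy)
            · intro s hs
              have hs0 : 0 < s := one_pos.trans_le hs.1
              rw [← Finset.sum_mul, ← hn n s (hs.2.trans htn), Real.rpow_sub hs0, Real.rpow_one]
              calc H s * (s ^ (-p) / s) ≤ s * h s * (s ^ (-p) / s) := by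
                    gcongr
                    exact hHle s hs0.le
                _ = _ := by field_simp
        _ = ∑ k ∈ Finset.range n, ∫ s in (1:ℝ)..t, g k s * s ^ (-p) :=
            intervalIntegral.integral_finsetSum (fun k _ => hgi k)
        _ ≤ ∑ k ∈ Finset.range n, (1 / 2) ^ k * (B (C * t) * t ^ (-p) / (p - 1)) :=
            Finset.sum_le_sum (fun k _ => hgk k)
        _ = (∑ k ∈ Finset.range n, (1 / 2 : ℝ) ^ k) * (B (C * t) * t ^ (-p) / (p - 1)) := by
            rw [Finset.sum_mul]
        _ ≤ 2 * (B (C * t) * t ^ (-p) / (p - 1)) := by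
            gcongr
            exact sum_geometric_two_le n
        _ = _ := by ring
    have hsum : (∫ s in (1:ℝ)..t, (A s + H s) * s ^ (-p - 1)) =
        (∫ s in (1:ℝ)..t, A s * s ^ (-p - 1)) + ∫ s in (1:ℝ)..t, H s * s ^ (-p - 1) := by
      rw [← intervalIntegral.integral_add (mono_ii hAm _ one_pos ht0) (mono_ii hHm _ one_pos ht0)]
      simp_rw [add_mul]
    have h1 := hred t ht
    simp only
    rw [hsum]
    calc _ ≤ c₀ * B (C * t) * t ^ (-p) + 2 / (p - 1) * (B (C * t) * t ^ (-p)) := add_le_add h1 hHint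
      _ = _ := by ring

theorem statement13 (α : ℝ) (hα : 0 < α) (hα1 : α < 1)
    (A B : ℝ → ℝ) (hA : IsYoung A) (hB : IsYoung B)
    (c₀ C : ℝ) (hc₀ : 0 < c₀) (hC : 0 < C)
    (hred : ∀ t : ℝ, 2 < t →
      (∫ s in Set.Ioo (1:ℝ) t, A s * s ^ (-(1/(1-α)) - 1))
        ≤ c₀ * B (C * t) * t ^ (-(1/(1-α))))
    (hBlim : Filter.Tendsto (fun t => B t / t ^ (1/(1-α))) Filter.atTop Filter.atTop)
    (hlimsup : ∀ K : ℝ, 1 ≤ K → ∀ M : ℝ, ∃ᶠ t in Filter.atTop,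
      M ≤ (t ^ (1/(1-α)) / B (K * t)) *
        ∫ s in Set.Ioo (1:ℝ) t, B s * s ^ (-(1/(1-α)) - 1)) :
    ∃ A₁ : ℝ → ℝ, IsYoung A₁ ∧
      (∀ t, 0 ≤ t → A t ≤ A₁ t) ∧
      (∀ lam : ℝ, 0 < lam → ∀ M : ℝ, ∃ᶠ t in Filter.atTop, M ≤ A₁ t / A (lam * t)) ∧
      ∃ c₁ : ℝ, 0 < c₁ ∧ ∀ t : ℝ, 2 < t →
        (∫ s in Set.Ioo (1:ℝ) t, A₁ s * s ^ (-(1/(1-α)) - 1))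
          ≤ c₁ * B (C * t) * t ^ (-(1/(1-α))) := by
  have hp : 1 < 1 / (1 - α) := by
    rw [lt_div_iff₀ (by linarith)]
    linarith
  obtain ⟨hAm, hAp⟩ := young_mono hA
  obtain ⟨hBm, hBp⟩ := young_mono hB
  have hred' : ∀ t : ℝ, 2 < t → (∫ s in (1:ℝ)..t, A s * s ^ (-(1/(1-α)) - 1)) ≤
      c₀ * B (C * t) * t ^ (-(1/(1-α))) := by
    intro t ht
    rw [← ioo_eq _ (by linarith : 1 ≤ t)]
    exact hred t ht
  obtain ⟨A₁, h1, h2, h3, c₁, hc₁, h4⟩ := build hp hA hBp hc₀ hC hred'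
    (fun l hl M hM => claim hp hAm hAp hBm hBp hc₀ hC hred' hBlim hlimsup hl hM)
  refine ⟨A₁, h1, h2, h3, c₁, hc₁, ?_⟩
  intro t ht
  rw [ioo_eq _ (by linarith : 1 ≤ t)]
  exact h4 t ht
end
end
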